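/- arXiv:2407.07272 — 2 statements merged into one kernel-verified Lean document; each statement's English description precedes it below -/
import Mathlib

section
/- For any spray G on a nonempty open set U ⊆ ℝ^n (n ≥ 2), the following identity holds on U × (ℝ^n \ {0}): R_{|p} − ½ R_{·p|m} y^m − (1/(n−1)) (χ_{p|m} y^m + R^m_{p|m}) = 0, where R is the Ricci scalar, χ_p the χ-curvature, R^m_p the Riemann curvature, and '|' the horizontal covariant derivative with respect to G. -/
open scoped BigOperators
open MeasureTheory

noncomputable section BerwaldWeyl

/-- Points/vectors in local coordinates on `ℝⁿ`. -/
abbrev Vec (n : ℕ) := Fin n → ℝ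

/-- Partial derivative in the base (`x`) variable along the `i`-th coordinate. -/
def pdx {n : ℕ} (f : Vec n → Vec n → ℝ) (i : Fin n) : Vec n → Vec n → ℝ :=
  fun x y => fderiv ℝ (fun x' => f x' y) x (Pi.single i 1)

/-- Vertical derivative `f_{·i} = ∂f/∂y^i`. -/
def pdy {n : ℕ} (f : Vec n → Vec n → ℝ) (i : Fin n) : Vec n → Vec n → ℝ :=
  fun x y => fderiv ℝ (fun y' => f x y') y (Pi.single i 1)

/-- The slit fiber `ℝⁿ \ {0}`. -/
def slit (n : ℕ) : Set (Vec n) := {y | y ≠ 0}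

/-- A spray on `U ⊆ ℝⁿ`: a family `G^i(x,y)`, smooth on `U × (ℝⁿ \ {0})` and
positively 2-homogeneous in `y`. -/
def IsSpray {n : ℕ} (U : Set (Vec n)) (G : Fin n → Vec n → Vec n → ℝ) : Prop :=
  (∀ i, ContDiffOn ℝ (⊤ : ℕ∞) (fun p : Vec n × Vec n => G i p.1 p.2) (U ×ˢ slit n)) ∧
  (∀ i, ∀ x ∈ U, ∀ y ∈ slit n, ∀ c : ℝ, 0 < c → G i x (c • y) = c ^ 2 * G i x y)

/-- Nonlinear connection coefficients `N^i_j := ∂G^i/∂y^j`. -/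
def Nc {n : ℕ} (G : Fin n → Vec n → Vec n → ℝ) (i j : Fin n) : Vec n → Vec n → ℝ :=
  pdy (G i) j

/-- Berwald connection coefficients `Γ^i_{jk} := ∂²G^i/∂y^j∂y^k`. -/
def Γc {n : ℕ} (G : Fin n → Vec n → Vec n → ℝ) (i j k : Fin n) : Vec n → Vec n → ℝ :=
  pdy (pdy (G i) j) k

/-- Horizontal derivative of a scalar: `f_{|k} := δf/δx^k = ∂f/∂x^k - N^l_k ∂f/∂y^l`. -/
def hD {n : ℕ} (G : Fin n → Vec n → Vec n → ℝ) (f : Vec n → Vec n → ℝ) (k : Fin n) :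
    Vec n → Vec n → ℝ :=
  fun x y => pdx f k x y - ∑ l, Nc G l k x y * pdy f l x y

/-- Horizontal covariant derivative `A_{j|m}` of a 1-form `A_j`. -/
def covD1 {n : ℕ} (G : Fin n → Vec n → Vec n → ℝ) (A : Fin n → Vec n → Vec n → ℝ)
    (j m : Fin n) : Vec n → Vec n → ℝ :=
  fun x y => hD G (A j) m x y - ∑ l, A l x y * Γc G l j m x y

/-- Horizontal covariant derivative `A^i_{j|m}` of a (1,1)-tensor `A^i_j`. -/
def covD11 {n : ℕ} (G : Fin n → Vec n → Vec n → ℝ)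
    (A : Fin n → Fin n → Vec n → Vec n → ℝ) (i j m : Fin n) : Vec n → Vec n → ℝ :=
  fun x y => hD G (A i j) m x y + ∑ l, A l j x y * Γc G i l m x y
    - ∑ l, A i l x y * Γc G l j m x y

/-- Horizontal covariant derivative `B^i_{jk|m}` of a (1,2)-tensor `B^i_{jk}`. -/
def covD12 {n : ℕ} (G : Fin n → Vec n → Vec n → ℝ)
    (B : Fin n → Fin n → Fin n → Vec n → Vec n → ℝ) (i j k m : Fin n) : Vec n → Vec n → ℝ :=
  fun x y => hD G (B i j k) m x y + ∑ l, B l j k x y * Γc G i l m x y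
    - ∑ l, B i l k x y * Γc G l j m x y - ∑ l, B i j l x y * Γc G l k m x y

/-- Riemann curvature `R^i_k`. -/
def Riem {n : ℕ} (G : Fin n → Vec n → Vec n → ℝ) (i k : Fin n) : Vec n → Vec n → ℝ :=
  fun x y => 2 * pdx (G i) k x y - ∑ j, y j * pdy (pdx (G i) j) k x y
    + 2 * ∑ j, G j x y * Γc G i j k x y - ∑ s, Nc G i s x y * Nc G s k x y

/-- Ricci scalar `R := R^m_m/(n-1)`. -/
def Ricci {n : ℕ} (G : Fin n → Vec n → Vec n → ℝ) : Vec n → Vec n → ℝ :=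
  fun x y => (∑ m, Riem G m m x y) / ((n : ℝ) - 1)

/-- The Weyl-type curvature `T^i_k := R^i_k - (R δ^i_k - ½ R_{·k} y^i)`. -/
def Tcurv {n : ℕ} (G : Fin n → Vec n → Vec n → ℝ) (i k : Fin n) : Vec n → Vec n → ℝ :=
  fun x y => Riem G i k x y -
    (Ricci G x y * (if i = k then 1 else 0) - (1/2) * pdy (Ricci G) k x y * y i)

/-- The χ-curvature `χ_i := -(1/3) T^m_{i·m}`. -/
def chiC {n : ℕ} (G : Fin n → Vec n → Vec n → ℝ) (i : Fin n) : Vec n → Vec n → ℝ :=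
  fun x y => -(1/3) * ∑ m, pdy (Tcurv G m i) m x y

/-- The Weyl curvature `W^i_k := T^i_k + (3χ_k/(n+1)) y^i`. -/
def Weyl {n : ℕ} (G : Fin n → Vec n → Vec n → ℝ) (i k : Fin n) : Vec n → Vec n → ℝ :=
  fun x y => Tcurv G i k x y + (3 * chiC G k x y / ((n : ℝ) + 1)) * y i

/-- A volume form `dV = σ(x) dx` on `U`: `σ` smooth and positive. -/
def IsVolumeForm {n : ℕ} (U : Set (Vec n)) (σ : Vec n → ℝ) : Prop :=
  ContDiffOn ℝ (⊤ : ℕ∞) σ U ∧ ∀ x ∈ U, 0 < σ x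

/-- The S-curvature of `(G, dV)`: `S := ∂G^m/∂y^m - y^m ∂(ln σ)/∂x^m`. -/
def Scurv {n : ℕ} (G : Fin n → Vec n → Vec n → ℝ) (σ : Vec n → ℝ) : Vec n → Vec n → ℝ :=
  fun x y => ∑ m, Nc G m m x y
    - ∑ m, y m * fderiv ℝ (fun x' => Real.log (σ x')) x (Pi.single m 1)

/-- The projective spray `Ĝ^i := G^i - (S/(n+1)) y^i` of `(G, dV)`. -/
def Ghat {n : ℕ} (G : Fin n → Vec n → Vec n → ℝ) (σ : Vec n → ℝ) :
    Fin n → Vec n → Vec n → ℝ :=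
  fun i x y => G i x y - (Scurv G σ x y / ((n : ℝ) + 1)) * y i

/-- The Berwald–Weyl curvature `W^o_k := R̂_{∥k} - ½ R̂_{·k∥m} y^m` of `(G, dV)`,
where all hatted quantities and `∥` are taken with respect to the projective spray `Ĝ`. -/
def BWeyl {n : ℕ} (G : Fin n → Vec n → Vec n → ℝ) (σ : Vec n → ℝ) (k : Fin n) :
    Vec n → Vec n → ℝ :=
  fun x y => hD (Ghat G σ) (Ricci (Ghat G σ)) k x y
    - (1/2) * ∑ m, covD1 (Ghat G σ) (fun j => pdy (Ricci (Ghat G σ)) j) k m x y * y m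


/-- Commuting horizontal and vertical derivations `X i`, `V i` on an algebra, with fibre coordinates
`y i` and spray coefficients `G i` homogeneous of degree two. -/
structure SprayAlgebra (ι A : Type*) [Fintype ι] [DecidableEq ι] [CommRing A] [Algebra ℝ A] where
  X : ι → Derivation ℝ A A
  V : ι → Derivation ℝ A A
  y : ι → A
  G : ι → A
  X_X : ∀ i j f, X i (X j f) = X j (X i f)
  V_X : ∀ i j f, V i (X j f) = X j (V i f)
  V_V : ∀ i j f, V i (V j f) = V j (V i f)
  X_y : ∀ i j, X i (y j) = 0
  V_y : ∀ i j, V i (y j) = if i = j then 1 else 0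
  euler_G : ∀ i, ∑ j, y j * V j (G i) = 2 * G i

namespace SprayAlgebra

variable {ι A : Type*} [Fintype ι] [DecidableEq ι] [CommRing A] [Algebra ℝ A]
  (S : SprayAlgebra ι A)

/-- Nonlinear connection coefficients. -/
def N (i j : ι) : A := S.V j (S.G i)

/-- Berwald connection coefficients. -/
def Γ (i j k : ι) : A := S.V k (S.V j (S.G i))

/-- The horizontal derivations `X k - N^l_k V l`. -/
def D (k : ι) : Derivation ℝ A A := S.X k - ∑ l, S.N l k • S.V l

/-- The curvature `K^i_{kl}` of the nonlinear connection. -/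
def K (i k l : ι) : A := S.D k (S.N i l) - S.D l (S.N i k)

/-- The Riemann curvature `R^i_k`. -/
def R (i k : ι) : A :=
  2 * S.X k (S.G i) - ∑ j, S.y j * S.V k (S.X j (S.G i)) + 2 * ∑ j, S.G j * S.Γ i j k
    - ∑ s, S.N i s * S.N s k

/-- The trace `R^m_m`. -/
def ric : A := ∑ m, S.R m m

/-- Horizontal covariant derivative `B_{j|m}`. -/
def cov (B : ι → A) (j m : ι) : A := S.D m (B j) - ∑ l, B l * S.Γ l j m

theorem D_apply (k : ι) (f : A) : S.D k f = S.X k f - ∑ l, S.N l k * S.V l f := by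
  have h (s : Finset ι) : (∑ l ∈ s, S.N l k • S.V l) f = ∑ l ∈ s, S.N l k * S.V l f := by
    induction s using Finset.induction_on with
    | empty => simp
    | insert a s ha ih => simp [Finset.sum_insert ha, ih]
  rw [D, Derivation.sub_apply, h]

theorem Γ_symm (i j k : ι) : S.Γ i j k = S.Γ i k j := S.V_V _ _ _

theorem V_N (i j k : ι) : S.V k (S.N i j) = S.Γ i j k := rfl

theorem D_y (k j : ι) : S.D k (S.y j) = -S.N j k := by
  simp [D_apply, S.X_y, S.V_y]

theorem K_antisymm (i k l : ι) : S.K i k l = -S.K i l k := by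
  simp [K]

theorem V_D (r m : ι) (f : A) :
    S.V r (S.D m f) = S.D m (S.V r f) - ∑ s, S.Γ s r m * S.V s f := by
  simp only [D_apply, map_sub, map_sum, Derivation.leibniz, smul_eq_mul, V_N, S.V_X,
    Finset.sum_add_distrib, S.V_V r]
  simp only [S.Γ_symm _ m r, mul_comm]
  ring

theorem D_comm (k l : ι) (f : A) :
    S.D k (S.D l f) - S.D l (S.D k f) = -∑ r, S.K r k l * S.V r f := by
  have expand (k l : ι) : S.D k (S.D l f) = S.X k (S.X l f) - ∑ r, S.N r k * S.X l (S.V r f)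
      - ∑ r, S.D k (S.N r l) * S.V r f - ∑ r, S.N r l * S.X k (S.V r f)
      + ∑ r, ∑ s, S.N r l * S.N s k * S.V s (S.V r f) := by
    rw [S.D_apply l f, map_sub, map_sum, S.D_apply k (S.X l f)]
    simp only [Derivation.leibniz, smul_eq_mul, S.V_X, Finset.sum_add_distrib]
    have h : ∑ r, S.N r l * S.D k (S.V r f) = ∑ r, S.N r l * S.X k (S.V r f)
        - ∑ r, ∑ s, S.N r l * S.N s k * S.V s (S.V r f) := by
      simp only [D_apply, mul_sub, Finset.sum_sub_distrib, Finset.mul_sum, mul_assoc]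
    rw [h]
    simp only [mul_comm (S.V _ f)]
    ring
  have swap : ∑ r, ∑ s, S.N r l * S.N s k * S.V s (S.V r f)
      = ∑ r, ∑ s, S.N r k * S.N s l * S.V s (S.V r f) := by
    rw [Finset.sum_comm]
    refine Finset.sum_congr rfl fun r _ => Finset.sum_congr rfl fun s _ => ?_
    rw [S.V_V]; ring
  rw [expand k l, expand l k, swap, S.X_X k l]
  simp only [K, sub_mul, Finset.sum_sub_distrib]
  ring

/-- Vertical differentiation lowers the weight for the Euler operator `y^l V_l` by one. -/
theorem euler_V (p : ι) (f : A) :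
    ∑ l, S.y l * S.V l (S.V p f) = S.V p (∑ l, S.y l * S.V l f) - S.V p f := by
  simp [map_sum, Derivation.leibniz, S.V_y, Finset.sum_add_distrib, S.V_V p]

theorem euler_N (i j : ι) : ∑ l, S.y l * S.V l (S.N i j) = S.N i j := by
  rw [N, euler_V, S.euler_G]
  have : S.V j (2 * S.G i) = 2 * S.V j (S.G i) := by
    rw [two_mul, map_add, two_mul]
  rw [this]; ring

theorem sum_y_Γ (i j : ι) : ∑ l, S.y l * S.Γ i j l = S.N i j := S.euler_N i j

theorem euler_D (m : ι) (f : A) :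
    ∑ l, S.y l * S.V l (S.D m f) = S.D m (∑ l, S.y l * S.V l f) := by
  have h : ∑ l, S.y l * ∑ s, S.Γ s l m * S.V s f = ∑ s, S.N s m * S.V s f := by
    simp only [Finset.mul_sum]
    rw [Finset.sum_comm]
    refine Finset.sum_congr rfl fun s _ => ?_
    rw [← S.sum_y_Γ s m, Finset.sum_mul]
    refine Finset.sum_congr rfl fun l _ => ?_
    rw [S.Γ_symm]; ring
  simp only [V_D, mul_sub, Finset.sum_sub_distrib, h, map_sum, Derivation.leibniz, smul_eq_mul,
    D_y, Finset.sum_add_distrib, mul_comm (S.V _ f), neg_mul, Finset.sum_neg_distrib]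
  ring

theorem euler_K (i k l : ι) : ∑ m, S.y m * S.V m (S.K i k l) = S.K i k l := by
  simp only [K, map_sub, mul_sub, Finset.sum_sub_distrib, euler_D, euler_N]

theorem R_eq_sum_K (i k : ι) : S.R i k = ∑ l, S.K i k l * S.y l := by
  have two (j : ι) : S.D k (2 * S.G j) = 2 * S.D k (S.G j) := by
    rw [two_mul, map_add, two_mul]
  have h₁ : ∑ l, S.D k (S.N i l) * S.y l = 2 * S.X k (S.G i) - ∑ s, S.N i s * S.N s k := by
    have h := congrArg (S.D k) (S.euler_G i)
    rw [two, D_apply S k (S.G i)] at h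
    simp only [map_sum, Derivation.leibniz, smul_eq_mul, D_y, Finset.sum_add_distrib, mul_neg,
      Finset.sum_neg_distrib] at h
    simp only [fun i j => show S.V j (S.G i) = S.N i j from rfl, mul_comm (S.N _ k)] at h
    simp only [mul_comm _ (S.y _)]
    linear_combination h
  have h₂ : ∑ l, S.D l (S.N i k) * S.y l
      = ∑ j, S.y j * S.V k (S.X j (S.G i)) - 2 * ∑ j, S.G j * S.Γ i j k := by
    simp only [D_apply, sub_mul, Finset.sum_sub_distrib, Finset.sum_mul]
    rw [Finset.sum_comm (f := fun l r => S.N r l * S.V r (S.N i k) * S.y l), Finset.mul_sum]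
    congr 1
    · refine Finset.sum_congr rfl fun j _ => ?_
      rw [S.V_X, N]; ring
    · refine Finset.sum_congr rfl fun j _ => ?_
      rw [← mul_assoc, ← S.euler_G j, Finset.sum_mul]
      refine Finset.sum_congr rfl fun l _ => ?_
      rw [S.V_N, S.Γ_symm i j k, N]; ring
  simp only [K, sub_mul, Finset.sum_sub_distrib, h₁, h₂, R]
  ring

theorem V_K_cyclic (i k l m : ι) :
    S.V m (S.K i k l) + S.V k (S.K i l m) + S.V l (S.K i m k) = 0 := by
  simp only [K, map_sub, V_D, V_N, S.Γ_symm i m l, S.Γ_symm i k l, S.Γ_symm i m k,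
    fun s => S.Γ_symm s m l, fun s => S.Γ_symm s k l, fun s => S.Γ_symm s m k]
  ring

theorem three_mul_K (i k l : ι) : 3 * S.K i k l = S.V l (S.R i k) - S.V k (S.R i l) := by
  have h (k l : ι) : S.V l (S.R i k) = S.K i k l + ∑ m, S.y m * S.V l (S.K i k m) := by
    simp [R_eq_sum_K, map_sum, Derivation.leibniz, S.V_y, Finset.sum_add_distrib]
  have h' : ∑ m, S.y m * S.V l (S.K i k m) - ∑ m, S.y m * S.V k (S.K i l m) = S.K i k l := by
    rw [← S.euler_K i k l, ← Finset.sum_sub_distrib]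
    refine Finset.sum_congr rfl fun m _ => ?_
    have := S.V_K_cyclic i k l m
    rw [S.K_antisymm i m k, map_neg] at this
    linear_combination (-S.y m) * this
  rw [h k l, h l k, S.K_antisymm i l k]
  linear_combination -h'

theorem euler_ric : ∑ l, S.y l * S.V l S.ric = 2 * S.ric := by
  have h (i k : ι) : ∑ l, S.y l * S.V l (S.R i k) = 2 * S.R i k := by
    have e (m : ι) : ∑ l, S.y l * S.V l (S.K i k m * S.y m) = 2 * (S.K i k m * S.y m) := by
      simp only [Derivation.leibniz, smul_eq_mul, S.V_y, mul_add, Finset.sum_add_distrib]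
      have : ∑ l, S.y l * (S.y m * S.V l (S.K i k m)) = S.y m * S.K i k m := by
        conv_rhs => rw [← S.euler_K i k m]
        rw [Finset.mul_sum]
        exact Finset.sum_congr rfl fun l _ => by ring
      rw [this]
      simp
      ring
    simp only [R_eq_sum_K, map_sum, Finset.mul_sum] at e ⊢
    rw [Finset.sum_comm]
    exact Finset.sum_congr rfl fun m _ => e m
  simp only [ric, map_sum, Finset.mul_sum] at h ⊢
  rw [Finset.sum_comm]
  exact Finset.sum_congr rfl fun m _ => h m m

theorem euler_V_ric (p : ι) : ∑ l, S.y l * S.V l (S.V p S.ric) = S.V p S.ric := by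
  rw [euler_V, euler_ric, two_mul, map_add]; ring

/-- The second Bianchi identity. -/
theorem D_K_cyclic (i k l m : ι) :
    S.D m (S.K i k l) + S.D k (S.K i l m) + S.D l (S.K i m k)
      = -(∑ r, S.K r k l * S.Γ i r m + ∑ r, S.K r l m * S.Γ i r k
          + ∑ r, S.K r m k * S.Γ i r l) := by
  have h₁ := S.D_comm k l (S.N i m)
  have h₂ := S.D_comm l m (S.N i k)
  have h₃ := S.D_comm m k (S.N i l)
  simp only [V_N, fun r s => S.Γ_symm i s r] at h₁ h₂ h₃ ⊢
  simp only [K, map_sub] at h₁ h₂ h₃ ⊢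
  linear_combination h₁ + h₂ + h₃

/-- The traced curvature `K^i_{pi}`. -/
def trK (p : ι) : A := ∑ i, S.K i p i

/-- The divergence `R^m_{p|m}`. -/
def divR (p : ι) : A :=
  ∑ m, (S.D m (S.R m p) + ∑ l, S.R l p * S.Γ m l m - ∑ l, S.R m l * S.Γ l p m)

theorem contracted_bianchi (p : ι) :
    ∑ m, S.cov S.trK p m * S.y m + S.D p S.ric - S.divR p = 0 := by
  have h₁ : ∑ m, S.cov S.trK p m * S.y m
      = ∑ i, ∑ m, S.D m (S.K i p i) * S.y m - ∑ i, ∑ m, S.K i m i * S.N m p := by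
    simp only [cov, trK, sub_mul, Finset.sum_sub_distrib, map_sum, Finset.sum_mul]
    congr 1
    · rw [Finset.sum_comm]
    · rw [Finset.sum_comm, Finset.sum_comm (f := fun i m => S.K i m i * S.N m p)]
      refine Finset.sum_congr rfl fun l _ => ?_
      rw [Finset.sum_comm]
      refine Finset.sum_congr rfl fun i _ => ?_
      rw [← S.sum_y_Γ l p, Finset.mul_sum]
      exact Finset.sum_congr rfl fun m _ => by ring
  have D_R (q i k : ι) : S.D q (S.R i k)
      = ∑ m, S.D q (S.K i k m) * S.y m - ∑ m, S.K i k m * S.N m q := by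
    simp only [R_eq_sum_K, map_sum, Derivation.leibniz, smul_eq_mul, D_y, Finset.sum_add_distrib,
      mul_neg, Finset.sum_neg_distrib, mul_comm (S.y _)]
    ring
  have h₂ : S.D p S.ric
      = ∑ i, ∑ m, S.D p (S.K i i m) * S.y m + ∑ i, ∑ m, S.K i m i * S.N m p := by
    simp only [ric, map_sum, D_R, Finset.sum_sub_distrib, fun i m => S.K_antisymm i m i, neg_mul,
      Finset.sum_neg_distrib]
    ring
  have h₃ : S.divR p
      = -∑ i, ∑ m, S.D i (S.K i m p) * S.y m - ∑ i, ∑ m, S.K i p m * S.N m i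
        + ∑ i, ∑ l, S.R l p * S.Γ i l i - ∑ i, ∑ l, S.R i l * S.Γ l p i := by
    simp only [divR, D_R, Finset.sum_sub_distrib, Finset.sum_add_distrib,
      fun i m => S.K_antisymm i m p, map_neg, neg_mul, Finset.sum_neg_distrib]
    ring
  have b₁ : ∑ i, ∑ m, (∑ r, S.K r p i * S.Γ i r m) * S.y m
      = ∑ i, ∑ m, S.K i p m * S.N m i := by
    rw [Finset.sum_comm (f := fun i m => S.K i p m * S.N m i)]
    refine Finset.sum_congr rfl fun i _ => ?_
    simp only [Finset.sum_mul]
    rw [Finset.sum_comm]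
    refine Finset.sum_congr rfl fun r _ => ?_
    rw [← S.sum_y_Γ i r, Finset.mul_sum]
    exact Finset.sum_congr rfl fun m _ => by ring
  have b₂ : ∑ i, ∑ m, (∑ r, S.K r i m * S.Γ i r p) * S.y m
      = ∑ i, ∑ l, S.R i l * S.Γ l p i := by
    rw [Finset.sum_comm (f := fun i l => S.R i l * S.Γ l p i)]
    refine Finset.sum_congr rfl fun i _ => ?_
    simp only [Finset.sum_mul]
    rw [Finset.sum_comm]
    refine Finset.sum_congr rfl fun r _ => ?_
    rw [R_eq_sum_K, Finset.sum_mul]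
    exact Finset.sum_congr rfl fun m _ => by rw [S.Γ_symm i r p]; ring
  have b₃ : ∑ i, ∑ m, (∑ r, S.K r m p * S.Γ i r i) * S.y m
      = -∑ i, ∑ l, S.R l p * S.Γ i l i := by
    rw [← Finset.sum_neg_distrib]
    refine Finset.sum_congr rfl fun i _ => ?_
    simp only [Finset.sum_mul]
    rw [Finset.sum_comm, ← Finset.sum_neg_distrib]
    refine Finset.sum_congr rfl fun r _ => ?_
    rw [R_eq_sum_K, Finset.sum_mul, ← Finset.sum_neg_distrib]
    exact Finset.sum_congr rfl fun m _ => by rw [S.K_antisymm r m p]; ring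
  have bianchi : ∑ i, ∑ m, (S.D m (S.K i p i) + S.D p (S.K i i m) + S.D i (S.K i m p)) * S.y m
      = ∑ i, ∑ m, -(∑ r, S.K r p i * S.Γ i r m + ∑ r, S.K r i m * S.Γ i r p
          + ∑ r, S.K r m p * S.Γ i r i) * S.y m := by
    simp only [D_K_cyclic]
  simp only [add_mul, neg_mul, Finset.sum_add_distrib, Finset.sum_neg_distrib, b₁, b₂, b₃]
    at bianchi
  rw [h₁, h₂, h₃]
  linear_combination bianchi

/-- The Ricci scalar `R^m_m / (n - 1)`. -/
noncomputable def ricciScalar : A := ((Fintype.card ι : ℝ) - 1)⁻¹ • S.ric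

/-- The tensor `T^i_k`. -/
noncomputable def T (i k : ι) : A :=
  S.R i k - (S.ricciScalar * (if i = k then 1 else 0)
    - (1 / 2 : ℝ) • (S.V k S.ricciScalar * S.y i))

/-- The `χ`-curvature. -/
noncomputable def χ (k : ι) : A := (-(1 / 3) : ℝ) • ∑ m, S.V m (S.T m k)

theorem χ_eq (h : (Fintype.card ι : ℝ) - 1 ≠ 0) (k : ι) :
    S.χ k = -S.trK k - (1 / 2 : ℝ) • S.V k S.ric := by
  have hK : (3 : ℝ) • S.trK k = ∑ m, S.V m (S.R m k) - S.V k S.ric := by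
    have h₃ (a : A) : (3 : ℝ) • a = 3 * a := by
      rw [Algebra.smul_def, map_ofNat]
    rw [h₃, trK, Finset.mul_sum, ric, map_sum, ← Finset.sum_sub_distrib]
    exact Finset.sum_congr rfl fun m _ => S.three_mul_K m k m
  have hT : ∑ m, S.V m (S.T m k) = ∑ m, S.V m (S.R m k) + (1 / 2 : ℝ) •
      (S.V k S.ric) := by
    set c : ℝ := (Fintype.card ι : ℝ) - 1 with hc
    have hn : (Fintype.card ι : ℝ) = c + 1 := by rw [hc]; ring
    have h₁ : ∑ m, S.V m (S.ricciScalar * (if m = k then 1 else 0)) = c⁻¹ • S.V k S.ric := by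
      rw [Finset.sum_eq_single k (fun m _ hm => by simp [hm]) (by simp)]
      simp [ricciScalar, ← hc]
    have h₂ : ∑ m, S.V m (S.V k S.ricciScalar * S.y m)
        = (c⁻¹ * (c + 2)) • S.V k S.ric := by
      simp only [ricciScalar, Derivation.leibniz, Derivation.map_smul, smul_eq_mul, S.V_y, if_true,
        mul_one, Finset.sum_add_distrib, mul_smul_comm, ← Finset.smul_sum, euler_V_ric,
        Finset.sum_const, Finset.card_univ, ← Nat.cast_smul_eq_nsmul ℝ, hn]
      module
    simp only [T, map_sub, Derivation.map_smul, Finset.sum_sub_distrib, ← Finset.smul_sum, h₁, h₂, smul_smul]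
    have : (1 / 2 : ℝ) * (c⁻¹ * (c + 2)) = 1 / 2 + c⁻¹ := by field_simp
    rw [this]
    module
  rw [χ, hT]
  linear_combination (norm := module) (1 / 3 : ℝ) • hK

theorem ricciScalar_identity (h : (Fintype.card ι : ℝ) - 1 ≠ 0) (p : ι) :
    S.D p S.ricciScalar - (1 / 2 : ℝ) • ∑ m, S.cov (fun j => S.V j S.ricciScalar) p m * S.y m
      - ((Fintype.card ι : ℝ) - 1)⁻¹ • (∑ m, S.cov S.χ p m * S.y m + S.divR p) = 0 := by
  have h₁ (m : ι) : S.cov S.χ p m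
      = -S.cov S.trK p m - (1 / 2 : ℝ) • S.cov (fun j => S.V j S.ric) p m := by
    simp only [cov, χ_eq S h, map_sub, map_neg, Derivation.map_smul, sub_mul, neg_mul, smul_mul_assoc,
      Finset.sum_sub_distrib, Finset.sum_neg_distrib, ← Finset.smul_sum]
    module
  have h₂ (m : ι) : S.cov (fun j => S.V j S.ricciScalar) p m
      = ((Fintype.card ι : ℝ) - 1)⁻¹ • S.cov (fun j => S.V j S.ric) p m := by
    simp only [cov, ricciScalar, Derivation.map_smul, smul_mul_assoc, ← Finset.smul_sum]
    module
  simp only [h₁, h₂, sub_mul, neg_mul, smul_mul_assoc, Finset.sum_sub_distrib,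
    Finset.sum_neg_distrib, ← Finset.smul_sum]
  rw [ricciScalar, Derivation.map_smul]
  linear_combination (norm := module)
    ((Fintype.card ι : ℝ) - 1)⁻¹ • S.contracted_bianchi p

end SprayAlgebra

section SmoothFunctions

variable {E : Type*} [NormedAddCommGroup E] [NormedSpace ℝ E]

/-- The algebra of smooth real functions on a subset `Ω` of a normed space. -/
def smoothAlgebra (Ω : Set E) : Subalgebra ℝ (Ω → ℝ) where
  carrier := {f | ∃ F : E → ℝ, ContDiffOn ℝ (⊤ : ℕ∞) F Ω ∧ ∀ p : Ω, F p = f p}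
  mul_mem' := by
    rintro f g ⟨F, hF, hFf⟩ ⟨H, hH, hHg⟩
    exact ⟨fun z => F z * H z, hF.mul hH, fun p => by simp [hFf, hHg]⟩
  add_mem' := by
    rintro f g ⟨F, hF, hFf⟩ ⟨H, hH, hHg⟩
    exact ⟨fun z => F z + H z, hF.add hH, fun p => by simp [hFf, hHg]⟩
  algebraMap_mem' c := ⟨fun _ => c, contDiffOn_const, fun p => by simp⟩

variable {Ω : Set E}

/-- A smooth function on the ambient space that restricts to `f`. -/
def smoothExt (f : smoothAlgebra Ω) : E → ℝ := f.2.choose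

theorem contDiffOn_smoothExt (f : smoothAlgebra Ω) : ContDiffOn ℝ (⊤ : ℕ∞) (smoothExt f) Ω :=
  f.2.choose_spec.1

theorem smoothExt_apply (f : smoothAlgebra Ω) (p : Ω) : smoothExt f p = f.1 p :=
  f.2.choose_spec.2 p

theorem differentiableAt_smoothExt (hΩ : IsOpen Ω) (f : smoothAlgebra Ω) (p : Ω) :
    DifferentiableAt ℝ (smoothExt f) p :=
  ((contDiffOn_smoothExt f).contDiffAt (hΩ.mem_nhds p.2)).differentiableAt (by simp)

theorem eventuallyEq_smoothExt (hΩ : IsOpen Ω) {f : smoothAlgebra Ω} {F : E → ℝ}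
    (h : ∀ p : Ω, F p = f.1 p) (p : Ω) : F =ᶠ[nhds (p : E)] smoothExt f := by
  filter_upwards [hΩ.mem_nhds p.2] with z hz
  rw [h ⟨z, hz⟩, ← smoothExt_apply f ⟨z, hz⟩]

/-- The directional derivative along `v` as a derivation of the algebra of smooth functions. -/
def dirDeriv (hΩ : IsOpen Ω) (v : E) : Derivation ℝ (smoothAlgebra Ω) (smoothAlgebra Ω) :=
  Derivation.mk'
    { toFun := fun f => ⟨fun p => fderiv ℝ (smoothExt f) p v,
        ⟨fun z => fderiv ℝ (smoothExt f) z v,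
          ((contDiffOn_smoothExt f).fderiv_of_isOpen hΩ (by simp)).clm_apply contDiffOn_const,
          fun _ => rfl⟩⟩
      map_add' := fun f g => by
        ext p
        have h : (fun z => smoothExt f z + smoothExt g z) =ᶠ[nhds (p : E)] smoothExt (f + g) :=
          eventuallyEq_smoothExt hΩ (fun q => by simp [smoothExt_apply]) p
        have hd := fderiv_fun_add (differentiableAt_smoothExt hΩ f p)
          (differentiableAt_smoothExt hΩ g p)
        simp [← h.fderiv_eq, hd]
      map_smul' := fun c f => by
        ext p
        have h : (fun z => c • smoothExt f z) =ᶠ[nhds (p : E)] smoothExt (c • f) :=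
          eventuallyEq_smoothExt hΩ (fun q => by simp [smoothExt_apply]) p
        have hd := fderiv_fun_const_smul (differentiableAt_smoothExt hΩ f p) c
        simp only [← h.fderiv_eq, hd]
        rfl }
    fun f g => by
      ext p
      have h : (fun z => smoothExt f z * smoothExt g z) =ᶠ[nhds (p : E)] smoothExt (f * g) :=
        eventuallyEq_smoothExt hΩ (fun q => by simp [smoothExt_apply]) p
      have hd := fderiv_fun_mul (differentiableAt_smoothExt hΩ f p)
        (differentiableAt_smoothExt hΩ g p)
      simp [← h.fderiv_eq, hd, smoothExt_apply]

theorem hasFDerivAt_of_eq (hΩ : IsOpen Ω) {f : smoothAlgebra Ω} {F : E → ℝ}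
    (h : ∀ p : Ω, F p = f.1 p) (p : Ω) : HasFDerivAt F (fderiv ℝ (smoothExt f) p) p :=
  (differentiableAt_smoothExt hΩ f p).hasFDerivAt.congr_of_eventuallyEq
    (eventuallyEq_smoothExt hΩ h p)

theorem dirDeriv_apply_of_eq (hΩ : IsOpen Ω) (v : E) {f : smoothAlgebra Ω} {F : E → ℝ}
    (h : ∀ p : Ω, F p = f.1 p) (p : Ω) : (dirDeriv hΩ v f).1 p = fderiv ℝ F p v := by
  rw [(hasFDerivAt_of_eq hΩ h p).fderiv]; rfl

theorem dirDeriv_comm (hΩ : IsOpen Ω) (v w : E) (f : smoothAlgebra Ω) :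
    dirDeriv hΩ v (dirDeriv hΩ w f) = dirDeriv hΩ w (dirDeriv hΩ v f) := by
  ext p
  have hf := (contDiffOn_smoothExt f).contDiffAt (hΩ.mem_nhds p.2)
  have key (v w : E) : (dirDeriv hΩ v (dirDeriv hΩ w f)).1 p
      = fderiv ℝ (fderiv ℝ (smoothExt f)) p v w := by
    rw [dirDeriv_apply_of_eq hΩ v (F := fun z => fderiv ℝ (smoothExt f) z w) (fun _ => rfl)]
    have hd : DifferentiableAt ℝ (fderiv ℝ (smoothExt f)) p :=
      (hf.fderiv_right (m := 1) (by norm_cast)).differentiableAt (by simp)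
    rw [fderiv_clm_apply hd (differentiableAt_const w)]
    simp
  rw [key, key]
  exact hf.isSymmSndFDerivAt (by simp; norm_cast) v w

end SmoothFunctions

section Spray

variable {n : ℕ} {Ω : Set (Vec n × Vec n)}

/-- The function `F` restricts to the smooth function `f` on `Ω`. -/
def Represents (F : Vec n → Vec n → ℝ) (f : smoothAlgebra Ω) : Prop :=
  ∀ p : Ω, F p.1.1 p.1.2 = f.1 p

namespace Represents

variable {F H : Vec n → Vec n → ℝ} {f g : smoothAlgebra Ω}

theorem add (hF : Represents F f) (hH : Represents H g) :
    Represents (fun x y => F x y + H x y) (f + g) := fun p => by simp [hF p, hH p]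

theorem sub (hF : Represents F f) (hH : Represents H g) :
    Represents (fun x y => F x y - H x y) (f - g) := fun p => by simp [hF p, hH p]

theorem mul (hF : Represents F f) (hH : Represents H g) :
    Represents (fun x y => F x y * H x y) (f * g) := fun p => by simp [hF p, hH p]

theorem const_mul (c : ℝ) (hF : Represents F f) :
    Represents (fun x y => c * F x y) (c • f) := fun p => by simp [hF p]

theorem two_mul (hF : Represents F f) : Represents (fun x y => 2 * F x y) (2 * f) := by
  rw [_root_.two_mul]
  exact fun p => by simp [hF p, _root_.two_mul]

theorem sum {ι : Type*} {s : Finset ι} {F : ι → Vec n → Vec n → ℝ} {f : ι → smoothAlgebra Ω}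
    (h : ∀ i, Represents (F i) (f i)) :
    Represents (fun x y => ∑ i ∈ s, F i x y) (∑ i ∈ s, f i) := fun p => by
  simp [Finset.sum_apply, fun i => h i p]

theorem pdx (hΩ : IsOpen Ω) (hF : Represents F f) (i : Fin n) :
    Represents (pdx F i) (dirDeriv hΩ (Pi.single i 1, 0) f) := fun p => by
  have h := hasFDerivAt_of_eq hΩ (F := fun z => F z.1 z.2) hF p
  have hc := HasFDerivAt.comp p.1.1 (f := fun x' => (x', p.1.2)) h
    ((hasFDerivAt_id p.1.1).prodMk (hasFDerivAt_const p.1.2 p.1.1))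
  simp only [_root_.pdx]
  exact (DFunLike.congr_fun hc.fderiv _).trans (by simp; rfl)

theorem pdy (hΩ : IsOpen Ω) (hF : Represents F f) (i : Fin n) :
    Represents (pdy F i) (dirDeriv hΩ (0, Pi.single i 1) f) := fun p => by
  have h := hasFDerivAt_of_eq hΩ (F := fun z => F z.1 z.2) hF p
  have hc := HasFDerivAt.comp p.1.2 (f := fun y' => (p.1.1, y')) h
    ((hasFDerivAt_const p.1.1 p.1.2).prodMk (hasFDerivAt_id p.1.2))
  simp only [_root_.pdy]
  exact (DFunLike.congr_fun hc.fderiv _).trans (by simp; rfl)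

end Represents

/-- The `i`-th fibre coordinate as a smooth function. -/
def fiberCoord (Ω : Set (Vec n × Vec n)) (i : Fin n) : smoothAlgebra Ω :=
  ⟨fun p => p.1.2 i, fun z => z.2 i, by fun_prop, fun _ => rfl⟩

theorem euler_of_homogeneous {F : Vec n → ℝ} {y : Vec n} (hF : DifferentiableAt ℝ F y)
    (h : ∀ c : ℝ, 0 < c → F (c • y) = c ^ 2 * F y) :
    ∑ j, y j * fderiv ℝ F y (Pi.single j 1) = 2 * F y := by
  have h₁ : HasDerivAt (fun c : ℝ => F (c • y)) (fderiv ℝ F y y) 1 := by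
    have hs : HasDerivAt (fun c : ℝ => c • y) y 1 := by
      simpa using (hasDerivAt_id (1 : ℝ)).smul_const y
    have hF' : HasFDerivAt F (fderiv ℝ F y) ((1 : ℝ) • y) := by
      rw [one_smul]; exact hF.hasFDerivAt
    exact hF'.comp_hasDerivAt 1 hs
  have h₂ : HasDerivAt (fun c : ℝ => F (c • y)) (2 * F y) 1 := by
    have hp : HasDerivAt (fun c : ℝ => c ^ 2 * F y) (2 * F y) 1 := by
      simpa using (hasDerivAt_pow 2 (1 : ℝ)).mul_const (F y)
    refine hp.congr_of_eventuallyEq ?_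
    filter_upwards [lt_mem_nhds (zero_lt_one' ℝ)] with c hc using h c hc
  rw [← h₁.unique h₂]
  have hsum : fderiv ℝ F y y = ∑ j, fderiv ℝ F y (Pi.single j (y j)) := by
    rw [← map_sum, Finset.univ_sum_single]
  rw [hsum]
  refine Finset.sum_congr rfl fun j _ => ?_
  rw [← smul_eq_mul, ← map_smul, ← Pi.single_smul, smul_eq_mul, mul_one]

variable {U : Set (Vec n)} {G : Fin n → Vec n → Vec n → ℝ}

theorem isOpen_prod_slit (hU : IsOpen U) : IsOpen (U ×ˢ slit n) :=
  hU.prod isOpen_ne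

/-- The algebraic data attached to a spray. -/
def IsSpray.sprayAlgebra (hG : IsSpray U G) (hU : IsOpen U) :
    SprayAlgebra (Fin n) (smoothAlgebra (U ×ˢ slit n)) where
  X i := dirDeriv (isOpen_prod_slit hU) (Pi.single i 1, 0)
  V i := dirDeriv (isOpen_prod_slit hU) (0, Pi.single i 1)
  y := fiberCoord _
  G i := ⟨fun p => G i p.1.1 p.1.2, _, hG.1 i, fun _ => rfl⟩
  X_X _ _ := dirDeriv_comm _ _ _
  V_X _ _ := dirDeriv_comm _ _ _
  V_V _ _ := dirDeriv_comm _ _ _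
  X_y i j := by
    ext p
    rw [dirDeriv_apply_of_eq (F := fun z => z.2 j) _ _ (fun _ => rfl)]
    have h : HasFDerivAt (fun z : Vec n × Vec n => z.2 j)
      ((ContinuousLinearMap.proj j).comp (ContinuousLinearMap.snd ℝ (Vec n) (Vec n))) p.1 :=
      ((ContinuousLinearMap.proj j).comp (ContinuousLinearMap.snd ℝ (Vec n) (Vec n))).hasFDerivAt
    simp [h.fderiv]
  V_y i j := by
    ext p
    rw [dirDeriv_apply_of_eq (F := fun z => z.2 j) _ _ (fun _ => rfl)]
    have h : HasFDerivAt (fun z : Vec n × Vec n => z.2 j)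
      ((ContinuousLinearMap.proj j).comp (ContinuousLinearMap.snd ℝ (Vec n) (Vec n))) p.1 :=
      ((ContinuousLinearMap.proj j).comp (ContinuousLinearMap.snd ℝ (Vec n) (Vec n))).hasFDerivAt
    rw [h.fderiv]
    split_ifs with hij
    · simp [hij]
    · simp [Ne.symm hij]
  euler_G i := by
    have hΩ := isOpen_prod_slit (n := n) hU
    set g : smoothAlgebra (U ×ˢ slit n) := ⟨fun p => G i p.1.1 p.1.2, _, hG.1 i, fun _ => rfl⟩
    have hg : Represents (G i) g := fun _ => rfl
    have hy (j : Fin n) : Represents (fun _ y => y j) (fiberCoord (U ×ˢ slit n) j) := fun _ => rfl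
    ext p
    rw [← Represents.two_mul hg p, ← Represents.sum (fun j => (hy j).mul (hg.pdy hΩ j)) p]
    refine euler_of_homogeneous ?_ (hG.2 i _ p.2.1 _ p.2.2)
    exact (hasFDerivAt_of_eq hΩ (F := fun z => G i z.1 z.2) hg p).differentiableAt.comp p.1.2
      (f := fun y' => (p.1.1, y')) ((differentiableAt_const p.1.1).prodMk differentiableAt_fun_id)

namespace IsSpray

theorem represents_G (hG : IsSpray U G) (hU : IsOpen U) (i : Fin n) :
    Represents (G i) ((hG.sprayAlgebra hU).G i) := fun _ => rfl

theorem represents_y (hG : IsSpray U G) (hU : IsOpen U) (i : Fin n) :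
    Represents (fun _ y => y i) ((hG.sprayAlgebra hU).y i) := fun _ => rfl

theorem represents_pdx (hG : IsSpray U G) (hU : IsOpen U) {F : Vec n → Vec n → ℝ}
    {f : smoothAlgebra (U ×ˢ slit n)} (hF : Represents F f) (i : Fin n) :
    Represents (pdx F i) ((hG.sprayAlgebra hU).X i f) := hF.pdx (isOpen_prod_slit hU) i

theorem represents_pdy (hG : IsSpray U G) (hU : IsOpen U) {F : Vec n → Vec n → ℝ}
    {f : smoothAlgebra (U ×ˢ slit n)} (hF : Represents F f) (i : Fin n) :
    Represents (pdy F i) ((hG.sprayAlgebra hU).V i f) := hF.pdy (isOpen_prod_slit hU) i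

theorem represents_Nc (hG : IsSpray U G) (hU : IsOpen U) (i j : Fin n) :
    Represents (Nc G i j) ((hG.sprayAlgebra hU).N i j) :=
  hG.represents_pdy hU (hG.represents_G hU i) j

theorem represents_Γc (hG : IsSpray U G) (hU : IsOpen U) (i j k : Fin n) :
    Represents (Γc G i j k) ((hG.sprayAlgebra hU).Γ i j k) :=
  hG.represents_pdy hU (hG.represents_Nc hU i j) k

theorem represents_hD (hG : IsSpray U G) (hU : IsOpen U) {F : Vec n → Vec n → ℝ}
    {f : smoothAlgebra (U ×ˢ slit n)} (hF : Represents F f) (k : Fin n) :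
    Represents (hD G F k) ((hG.sprayAlgebra hU).D k f) := by
  rw [SprayAlgebra.D_apply]
  exact (hG.represents_pdx hU hF k).sub
    (.sum fun l => (hG.represents_Nc hU l k).mul (hG.represents_pdy hU hF l))

theorem represents_covD1 (hG : IsSpray U G) (hU : IsOpen U) {B : Fin n → Vec n → Vec n → ℝ}
    {b : Fin n → smoothAlgebra (U ×ˢ slit n)} (hB : ∀ i, Represents (B i) (b i)) (j m : Fin n) :
    Represents (covD1 G B j m) ((hG.sprayAlgebra hU).cov b j m) :=
  (hG.represents_hD hU (hB j) m).sub (.sum fun l => (hB l).mul (hG.represents_Γc hU l j m))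

theorem represents_Riem (hG : IsSpray U G) (hU : IsOpen U) (i k : Fin n) :
    Represents (Riem G i k) ((hG.sprayAlgebra hU).R i k) :=
  (((hG.represents_pdx hU (hG.represents_G hU i) k).two_mul.sub
    (.sum fun j => (hG.represents_y hU j).mul
      (hG.represents_pdy hU (hG.represents_pdx hU (hG.represents_G hU i) j) k))).add
    (Represents.two_mul
      (.sum fun j => (hG.represents_G hU j).mul (hG.represents_Γc hU i j k)))).sub
    (.sum fun s => (hG.represents_Nc hU i s).mul (hG.represents_Nc hU s k))

theorem represents_divR (hG : IsSpray U G) (hU : IsOpen U) (p : Fin n) :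
    Represents (fun x y => ∑ m, covD11 G (Riem G) m p m x y) ((hG.sprayAlgebra hU).divR p) :=
  .sum fun m => ((hG.represents_hD hU (hG.represents_Riem hU m p) m).add
    (.sum fun l => (hG.represents_Riem hU l p).mul (hG.represents_Γc hU m l m))).sub
    (.sum fun l => (hG.represents_Riem hU m l).mul (hG.represents_Γc hU l p m))

theorem represents_Ricci (hG : IsSpray U G) (hU : IsOpen U) :
    Represents (Ricci G) (hG.sprayAlgebra hU).ricciScalar := fun p => by
  have h := Represents.sum (s := Finset.univ) (fun m => hG.represents_Riem hU m m) p
  simp [Ricci, SprayAlgebra.ricciScalar, SprayAlgebra.ric, h, div_eq_inv_mul]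

theorem represents_Tcurv (hG : IsSpray U G) (hU : IsOpen U) (i k : Fin n) :
    Represents (Tcurv G i k) ((hG.sprayAlgebra hU).T i k) := by
  have hδ : Represents (fun _ _ => if i = k then 1 else 0)
      (if i = k then 1 else 0 : smoothAlgebra (U ×ˢ slit n)) := fun p => by
    split_ifs <;> rfl
  have h := (hG.represents_Riem hU i k).sub (((hG.represents_Ricci hU).mul hδ).sub
    (((hG.represents_pdy hU (hG.represents_Ricci hU) k).mul (hG.represents_y hU i)).const_mul
      (1 / 2)))
  exact fun p => by rw [SprayAlgebra.T, ← h p, Tcurv, mul_assoc]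

theorem represents_chiC (hG : IsSpray U G) (hU : IsOpen U) (k : Fin n) :
    Represents (chiC G k) ((hG.sprayAlgebra hU).χ k) :=
  Represents.const_mul _ (.sum fun m => hG.represents_pdy hU (hG.represents_Tcurv hU m k) m)

end IsSpray

end Spray

/-- Proposition 2.3: for any spray,
`R_{|p} - ½ R_{·p|m} y^m - (1/(n-1))(χ_{p|m} y^m + R^m_{p|m}) = 0`. -/
theorem stmt_7 {n : ℕ} (hn : 2 ≤ n) (U : Set (Vec n)) (hU : IsOpen U) (hUne : U.Nonempty)
    (G : Fin n → Vec n → Vec n → ℝ) (hG : IsSpray U G) :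
    ∀ x ∈ U, ∀ y ∈ slit n, ∀ p : Fin n,
      hD G (Ricci G) p x y
        - (1/2) * ∑ m, covD1 G (fun j => pdy (Ricci G) j) p m x y * y m
        - (1/((n : ℝ) - 1)) *
            (∑ m, covD1 G (chiC G) p m x y * y m + ∑ m, covD11 G (Riem G) m p m x y)
        = 0 := by
  intro x hx y hy p
  have hc : (Fintype.card (Fin n) : ℝ) - 1 ≠ 0 := by
    have : (2 : ℝ) ≤ n := by exact_mod_cast hn
    rw [Fintype.card_fin]
    linarith
  have hcov {B : Fin n → Vec n → Vec n → ℝ} {b : Fin n → smoothAlgebra (U ×ˢ slit n)}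
      (hB : ∀ i, Represents (B i) (b i)) :
      Represents (fun x y => ∑ m, covD1 G B p m x y * y m)
        (∑ m, (hG.sprayAlgebra hU).cov b p m * (hG.sprayAlgebra hU).y m) :=
    .sum fun m => (hG.represents_covD1 hU hB p m).mul (hG.represents_y hU m)
  have h := (((hG.represents_hD hU (hG.represents_Ricci hU) p).sub
    ((hcov fun j => hG.represents_pdy hU (hG.represents_Ricci hU) j).const_mul (1 / 2))).sub
    (((hcov (hG.represents_chiC hU)).add (hG.represents_divR hU p)).const_mul
      ((Fintype.card (Fin n) : ℝ) - 1)⁻¹)) ⟨(x, y), hx, hy⟩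
  rw [SprayAlgebra.ricciScalar_identity _ hc p, Fintype.card_fin] at h
  rw [one_div ((n : ℝ) - 1)]
  exact h

end BerwaldWeyl
end

section
/- Let G be a spray on a nonempty open set U ⊆ ℝ^n (n ≥ 2), dV a volume form on U with S-curvature S, and Ĝ the projective spray of (G,dV). Set τ := (S/(n+1))² + (1/(n+1)) S_{|m} y^m. Then the Riemann curvatures and Ricci scalars of Ĝ and G are related by R̂^i_k = R^i_k + τ δ^i_k − ½ τ_{·k} y^i + (3χ_k/(n+1)) y^i and R̂ = R + τ, where χ_k = ½(S_{|m·k} y^m − S_{|k}) and '|' is the horizontal covariant derivative with respect to G. -/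
open scoped BigOperators
open MeasureTheory

noncomputable section BerwaldWeyl

/-- The function `τ := (S/(n+1))² + (1/(n+1)) S_{|m} y^m`. -/
def tauQ {n : ℕ} (G : Fin n → Vec n → Vec n → ℝ) (σ : Vec n → ℝ) : Vec n → Vec n → ℝ :=
  fun x y => (Scurv G σ x y / ((n : ℝ) + 1)) ^ 2
    + (1/((n : ℝ) + 1)) * ∑ m, hD G (Scurv G σ) m x y * y m

section SlitCalculus

/-- Joint smoothness on `U × (ℝⁿ \ {0})`. -/
def SlitSmooth {n : ℕ} (U : Set (Vec n)) (f : Vec n → Vec n → ℝ) : Prop :=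
  ContDiffOn ℝ (⊤ : ℕ∞) (fun p : Vec n × Vec n => f p.1 p.2) (U ×ˢ slit n)

/-- Positive `d`-homogeneity in the fibre variable. -/
def SlitHom {n : ℕ} (U : Set (Vec n)) (d : ℕ) (f : Vec n → Vec n → ℝ) : Prop :=
  ∀ x ∈ U, ∀ y ∈ slit n, ∀ c : ℝ, 0 < c → f x (c • y) = c ^ d * f x y

variable {n : ℕ} {U : Set (Vec n)} {f g : Vec n → Vec n → ℝ} {x y : Vec n}

theorem isOpen_slit : IsOpen (slit n) := isOpen_ne

theorem smul_mem_slit (hy : y ∈ slit n) {c : ℝ} (hc : 0 < c) : c • y ∈ slit n :=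
  smul_ne_zero hc.ne' hy

namespace SlitSmooth

theorem contDiffAt (hf : SlitSmooth U f) (hU : IsOpen U) (hx : x ∈ U) (hy : y ∈ slit n) :
    ContDiffAt ℝ (⊤ : ℕ∞) (fun p : Vec n × Vec n => f p.1 p.2) (x, y) :=
  ContDiffOn.contDiffAt hf ((hU.prod isOpen_slit).mem_nhds ⟨hx, hy⟩)

theorem differentiableAt (hf : SlitSmooth U f) (hU : IsOpen U) (hx : x ∈ U) (hy : y ∈ slit n) :
    DifferentiableAt ℝ (fun p : Vec n × Vec n => f p.1 p.2) (x, y) :=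
  (hf.contDiffAt hU hx hy).differentiableAt (by simp)

theorem hasFDerivAt_base (hf : SlitSmooth U f) (hU : IsOpen U) (hx : x ∈ U) (hy : y ∈ slit n) :
    HasFDerivAt (fun x' => f x' y)
      ((fderiv ℝ (fun p : Vec n × Vec n => f p.1 p.2) (x, y)).comp
        (ContinuousLinearMap.inl ℝ (Vec n) (Vec n))) x :=
  HasFDerivAt.comp x (f := fun x' => (x', y)) (hf.differentiableAt hU hx hy).hasFDerivAt
    (hasFDerivAt_prodMk_left x y)

theorem hasFDerivAt_fiber (hf : SlitSmooth U f) (hU : IsOpen U) (hx : x ∈ U) (hy : y ∈ slit n) :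
    HasFDerivAt (fun y' => f x y')
      ((fderiv ℝ (fun p : Vec n × Vec n => f p.1 p.2) (x, y)).comp
        (ContinuousLinearMap.inr ℝ (Vec n) (Vec n))) y :=
  HasFDerivAt.comp y (f := fun y' => (x, y')) (hf.differentiableAt hU hx hy).hasFDerivAt
    (hasFDerivAt_prodMk_right x y)

theorem differentiableAt_base (hf : SlitSmooth U f) (hU : IsOpen U) (hx : x ∈ U)
    (hy : y ∈ slit n) : DifferentiableAt ℝ (fun x' => f x' y) x :=
  (hf.hasFDerivAt_base hU hx hy).differentiableAt

theorem differentiableAt_fiber (hf : SlitSmooth U f) (hU : IsOpen U) (hx : x ∈ U)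
    (hy : y ∈ slit n) : DifferentiableAt ℝ (fun y' => f x y') y :=
  (hf.hasFDerivAt_fiber hU hx hy).differentiableAt

theorem fderiv_apply (hf : SlitSmooth U f) (hU : IsOpen U) (v : Vec n × Vec n) :
    SlitSmooth U
      (fun x y => fderiv ℝ (fun p : Vec n × Vec n => f p.1 p.2) (x, y) v) :=
  ContDiffOn.clm_apply
    (ContDiffOn.fderiv_of_isOpen hf (hU.prod isOpen_slit) (m := (⊤ : ℕ∞)) (by simp))
    contDiffOn_const

theorem congr (hf : SlitSmooth U f) (h : ∀ x ∈ U, ∀ y ∈ slit n, g x y = f x y) :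
    SlitSmooth U g :=
  ContDiffOn.congr hf fun p hp => h p.1 hp.1 p.2 hp.2

theorem pdx (hf : SlitSmooth U f) (hU : IsOpen U) (i : Fin n) : SlitSmooth U (pdx f i) :=
  (hf.fderiv_apply hU (Pi.single i 1, 0)).congr fun x hx y hy => by
    simp [_root_.pdx, (hf.hasFDerivAt_base hU hx hy).fderiv]

theorem pdy (hf : SlitSmooth U f) (hU : IsOpen U) (i : Fin n) : SlitSmooth U (pdy f i) :=
  (hf.fderiv_apply hU (0, Pi.single i 1)).congr fun x hx y hy => by
    simp [_root_.pdy, (hf.hasFDerivAt_fiber hU hx hy).fderiv]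

theorem sub (hf : SlitSmooth U f) (hg : SlitSmooth U g) :
    SlitSmooth U (fun x y => f x y - g x y) := ContDiffOn.sub hf hg

theorem mul (hf : SlitSmooth U f) (hg : SlitSmooth U g) :
    SlitSmooth U (fun x y => f x y * g x y) := ContDiffOn.mul hf hg

theorem div_const (hf : SlitSmooth U f) (r : ℝ) :
    SlitSmooth U (fun x y => f x y / r) := ContDiffOn.div_const hf r

theorem sum {F : Fin n → Vec n → Vec n → ℝ} (hF : ∀ i, SlitSmooth U (F i)) :
    SlitSmooth U (fun x y => ∑ i, F i x y) := ContDiffOn.sum fun i _ => hF i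

theorem coord (i : Fin n) : SlitSmooth U (fun _ y => y i) :=
  ((contDiff_apply ℝ ℝ i).comp contDiff_snd).contDiffOn

theorem of_base {φ : Vec n → ℝ} (hφ : ContDiffOn ℝ (⊤ : ℕ∞) φ U) :
    SlitSmooth U (fun x _ => φ x) :=
  hφ.comp contDiffOn_fst fun _ hp => hp.1

end SlitSmooth

theorem pdy_congr (hx : x ∈ U) (hy : y ∈ slit n)
    (h : ∀ x ∈ U, ∀ y ∈ slit n, f x y = g x y) (i : Fin n) : pdy f i x y = pdy g i x y := by
  have : (fun y' => f x y') =ᶠ[nhds y] fun y' => g x y' := by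
    filter_upwards [isOpen_slit.mem_nhds hy] with y' hy' using h x hx y' hy'
  simp only [pdy, this.fderiv_eq]

theorem pdy_coord (i k : Fin n) :
    pdy (fun _ y => y i) k x y = if i = k then 1 else 0 := by
  simp only [pdy]
  rw [(hasFDerivAt_apply i y).fderiv]
  simp [Pi.single_apply]


theorem pdx_congr (hU : IsOpen U) (hx : x ∈ U) (hy : y ∈ slit n)
    (h : ∀ x ∈ U, ∀ y ∈ slit n, f x y = g x y) (i : Fin n) : pdx f i x y = pdx g i x y := by
  have : (fun x' => f x' y) =ᶠ[nhds x] fun x' => g x' y := by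
    filter_upwards [hU.mem_nhds hx] with x' hx' using h x' hx' y hy
  simp only [pdx, this.fderiv_eq]

theorem pdy_sub (hU : IsOpen U) (hx : x ∈ U) (hy : y ∈ slit n) (hf : SlitSmooth U f)
    (hg : SlitSmooth U g) (k : Fin n) :
    pdy (fun x y => f x y - g x y) k x y = pdy f k x y - pdy g k x y := by
  simp only [pdy]
  rw [fderiv_fun_sub (hf.differentiableAt_fiber hU hx hy) (hg.differentiableAt_fiber hU hx hy)]
  simp

theorem pdy_mul (hU : IsOpen U) (hx : x ∈ U) (hy : y ∈ slit n) (hf : SlitSmooth U f)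
    (hg : SlitSmooth U g) (k : Fin n) :
    pdy (fun x y => f x y * g x y) k x y = f x y * pdy g k x y + g x y * pdy f k x y := by
  simp only [pdy]
  rw [fderiv_fun_mul (hf.differentiableAt_fiber hU hx hy) (hg.differentiableAt_fiber hU hx hy)]
  simp

theorem pdy_sum (hU : IsOpen U) (hx : x ∈ U) (hy : y ∈ slit n)
    {F : Fin n → Vec n → Vec n → ℝ} (hF : ∀ i, SlitSmooth U (F i)) (k : Fin n) :
    pdy (fun x y => ∑ i, F i x y) k x y = ∑ i, pdy (F i) k x y := by
  simp only [pdy]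
  rw [fderiv_fun_sum fun i _ => (hF i).differentiableAt_fiber hU hx hy]
  simp

theorem pdy_sub_div_mul (hU : IsOpen U) (hx : x ∈ U) (hy : y ∈ slit n)
    {s w : Vec n → Vec n → ℝ} (hf : SlitSmooth U f) (hs : SlitSmooth U s)
    (hw : SlitSmooth U w) (r : ℝ) (k : Fin n) :
    pdy (fun x y => f x y - s x y / r * w x y) k x y =
      pdy f k x y - (pdy s k x y / r * w x y + s x y / r * pdy w k x y) := by
  rw [pdy_sub hU hx hy hf ((hs.div_const r).mul hw), pdy_mul hU hx hy (hs.div_const r) hw]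
  have : pdy (fun x y => s x y / r) k x y = pdy s k x y / r := by
    simp only [pdy, div_eq_mul_inv]
    rw [fderiv_mul_const (hs.differentiableAt_fiber hU hx hy)]
    simp [mul_comm]
  rw [this]
  ring

theorem pdx_sub_div_mul_coord (hU : IsOpen U) (hx : x ∈ U) (hy : y ∈ slit n)
    {s : Vec n → Vec n → ℝ} (hf : SlitSmooth U f) (hs : SlitSmooth U s) (r : ℝ) (i k : Fin n) :
    pdx (fun x y => f x y - s x y / r * y i) k x y = pdx f k x y - pdx s k x y / r * y i := by
  have hs' := hs.differentiableAt_base hU hx hy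
  simp only [pdx, div_eq_mul_inv]
  rw [fderiv_fun_sub (hf.differentiableAt_base hU hx hy) ((hs'.mul_const _).mul_const _),
    fderiv_mul_const (hs'.mul_const _), fderiv_mul_const hs']
  simp
  ring

theorem hD_smooth {G : Fin n → Vec n → Vec n → ℝ} (hU : IsOpen U)
    (hG : ∀ i, SlitSmooth U (G i)) (hf : SlitSmooth U f) (k : Fin n) :
    SlitSmooth U (hD G f k) :=
  (hf.pdx hU k).sub (SlitSmooth.sum fun l => ((hG l).pdy hU k).mul (hf.pdy hU l))

namespace SlitHom

theorem pdy (hU : IsOpen U) (hf : SlitSmooth U f) {d : ℕ} (h : SlitHom U (d + 1) f)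
    (i : Fin n) : SlitHom U d (pdy f i) := by
  intro x hx y hy c hc
  have h1 : HasFDerivAt (fun y' => f x (c • y'))
      ((fderiv ℝ (fun y' => f x y') (c • y)).comp (c • ContinuousLinearMap.id ℝ (Vec n))) y :=
    HasFDerivAt.comp y (f := fun y' : Vec n => c • y')
      (hf.differentiableAt_fiber hU hx (smul_mem_slit hy hc)).hasFDerivAt
      ((hasFDerivAt_id y).const_smul c)
  have h2 : HasFDerivAt (fun y' => c ^ (d + 1) * f x y')
      (c ^ (d + 1) • fderiv ℝ (fun y' => f x y') y) y :=
    (hf.differentiableAt_fiber hU hx hy).hasFDerivAt.const_mul _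
  have h3 : (fun y' => f x (c • y')) =ᶠ[nhds y] fun y' => c ^ (d + 1) * f x y' := by
    filter_upwards [isOpen_slit.mem_nhds hy] with y' hy' using h x hx y' hy' c hc
  have := congrArg (fun L => L (Pi.single i 1)) ((h2.congr_of_eventuallyEq h3).unique h1)
  simp only [smul_apply, ContinuousLinearMap.comp_apply,
    ContinuousLinearMap.id_apply, map_smul, smul_eq_mul] at this
  simp only [_root_.pdy]
  have hc' := hc.ne'
  apply mul_left_cancel₀ hc'
  rw [← this]
  ring

theorem pdx (hU : IsOpen U) (hf : SlitSmooth U f) {d : ℕ} (h : SlitHom U d f) (i : Fin n) :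
    SlitHom U d (pdx f i) := by
  intro x hx y hy c hc
  have h3 : (fun x' => f x' (c • y)) =ᶠ[nhds x] fun x' => c ^ d * f x' y := by
    filter_upwards [hU.mem_nhds hx] with x' hx' using h x' hx' y hy c hc
  simp only [_root_.pdx]
  rw [h3.fderiv_eq, fderiv_const_mul (hf.differentiableAt_base hU hx hy)]
  simp

theorem euler (hU : IsOpen U) (hf : SlitSmooth U f) {d : ℕ} (h : SlitHom U d f)
    (hx : x ∈ U) (hy : y ∈ slit n) : ∑ j, y j * _root_.pdy f j x y = d * f x y := by
  have h1 : HasDerivAt (fun c : ℝ => f x (c • y)) (fderiv ℝ (fun y' => f x y') y y) 1 := by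
    have hd : HasFDerivAt (fun y' => f x y') (fderiv ℝ (fun y' => f x y') y) ((1 : ℝ) • y) := by
      simpa using (hf.differentiableAt_fiber hU hx hy).hasFDerivAt
    have hc : HasDerivAt (fun c : ℝ => c • y) y 1 := by
      simpa using (hasDerivAt_id (1 : ℝ)).smul_const y
    exact hd.comp_hasDerivAt (1 : ℝ) hc
  have h2 : HasDerivAt (fun c : ℝ => c ^ d * f x y) (d * f x y) 1 := by
    simpa using (hasDerivAt_pow d (1 : ℝ)).mul_const (f x y)
  have h3 : (fun c : ℝ => f x (c • y)) =ᶠ[nhds 1] fun c => c ^ d * f x y := by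
    filter_upwards [lt_mem_nhds one_pos] with c hc using h x hx y hy c hc
  rw [← (h1.congr_of_eventuallyEq h3.symm).unique h2]
  conv_rhs => arg 2; rw [pi_eq_sum_univ' y]
  simp [_root_.pdy, map_sum]

theorem euler_pdy (hU : IsOpen U) (hf : SlitSmooth U f) {d : ℕ} (h : SlitHom U (d + 1) f)
    (hx : x ∈ U) (hy : y ∈ slit n) (k : Fin n) :
    ∑ j, y j * _root_.pdy (_root_.pdy f j) k x y = d * _root_.pdy f k x y := by
  have h1 := pdy_congr hx hy (fun x hx y hy => h.euler hU hf hx hy) k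
  rw [pdy_sum hU hx hy (fun i => (SlitSmooth.coord i).mul (hf.pdy hU i))] at h1
  have h2 : ∀ j, _root_.pdy (fun x y => y j * _root_.pdy f j x y) k x y =
      y j * _root_.pdy (_root_.pdy f j) k x y +
        _root_.pdy f j x y * if j = k then 1 else 0 := fun j => by
    rw [pdy_mul hU hx hy (SlitSmooth.coord j) (hf.pdy hU j), pdy_coord]
  have h3 : _root_.pdy (fun x y => ((d + 1 : ℕ) : ℝ) * f x y) k x y =
      ((d + 1 : ℕ) : ℝ) * _root_.pdy f k x y := by
    simp only [_root_.pdy]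
    rw [fderiv_const_mul (hf.differentiableAt_fiber hU hx hy)]
    simp
  rw [h3] at h1
  simp only [h2, Finset.sum_add_distrib, mul_ite, mul_one, mul_zero, Finset.sum_ite_eq',
    Finset.mem_univ, if_true] at h1
  push_cast at h1
  linarith

theorem hD {G : Fin n → Vec n → Vec n → ℝ} (hU : IsOpen U) (hG : ∀ i, SlitSmooth U (G i))
    (hG2 : ∀ i, SlitHom U 2 (G i)) (hf : SlitSmooth U f) (h : SlitHom U 1 f) (k : Fin n) :
    SlitHom U 1 (hD G f k) := by
  intro x hx y hy c hc
  have hN := fun l => (hG2 l).pdy hU (hG l) k x hx y hy c hc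
  have hP := fun l => h.pdy (d := 0) hU hf l x hx y hy c hc
  simp only [_root_.hD, Nc, h.pdx hU hf k x hx y hy c hc, hN, hP, pow_one, pow_zero, one_mul,
    mul_sub, Finset.mul_sum, mul_assoc]

end SlitHom

section Spray

variable {G : Fin n → Vec n → Vec n → ℝ} {σ : Vec n → ℝ}

theorem Scurv_smooth (hU : IsOpen U) (hG : ∀ i, SlitSmooth U (G i)) (hσ : IsVolumeForm U σ) :
    SlitSmooth U (Scurv G σ) := by
  refine (SlitSmooth.sum fun m => (hG m).pdy hU m).sub
    (SlitSmooth.sum fun m => (SlitSmooth.coord m).mul (SlitSmooth.of_base ?_))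
  exact ((hσ.1.log fun x hx => (hσ.2 x hx).ne').fderiv_of_isOpen hU (m := (⊤ : ℕ∞))
    (by simp)).clm_apply contDiffOn_const

theorem Scurv_hom (hU : IsOpen U) (hG : ∀ i, SlitSmooth U (G i))
    (hG2 : ∀ i, SlitHom U 2 (G i)) : SlitHom U 1 (Scurv G σ) := by
  intro x hx y hy c hc
  have hN := fun l => (hG2 l).pdy hU (hG l) l x hx y hy c hc
  simp only [Scurv, Nc, hN, pow_one, Pi.smul_apply, smul_eq_mul, mul_sub, Finset.mul_sum,
    mul_assoc]

/-- The change of the Riemann curvature under `G ↦ G - (S / r) y`, in coordinates. -/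
theorem Riem_projective_change (hU : IsOpen U) (hG : ∀ i, SlitSmooth U (G i))
    (hG2 : ∀ i, SlitHom U 2 (G i)) {S : Vec n → Vec n → ℝ} (hS : SlitSmooth U S)
    (hS1 : SlitHom U 1 S) (r : ℝ) (hx : x ∈ U) (hy : y ∈ slit n) (i k : Fin n) :
    Riem (fun i x y => G i x y - S x y / r * y i) i k x y = Riem G i k x y
      + ((S x y / r) ^ 2 + (1 / r) * ∑ j, y j * pdx S j x y
          - (2 / r) * ∑ j, G j x y * pdy S j x y) * (if i = k then 1 else 0)
      + (-(2 / r) * pdx S k x y + (1 / r) * ∑ j, y j * pdy (pdx S j) k x y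
          - (2 / r) * ∑ j, G j x y * pdy (pdy S j) k x y - S x y * pdy S k x y / r ^ 2
          + (1 / r) * ∑ j, pdy S j x y * Nc G j k x y) * y i := by
  have hN : ∀ i j, ∀ x ∈ U, ∀ y ∈ slit n,
      Nc (fun i x y => G i x y - S x y / r * y i) i j x y = Nc G i j x y
        - pdy S j x y / r * y i - S x y / r * (if i = j then 1 else 0) := by
    intro i j x hx y hy
    simp only [Nc]
    rw [pdy_sub_div_mul hU hx hy (hG i) hS (SlitSmooth.coord i), pdy_coord]
    ring
  have hΓ : ∀ i j k, Γc (fun i x y => G i x y - S x y / r * y i) i j k x y = Γc G i j k x y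
        - pdy (pdy S j) k x y / r * y i - pdy S j x y / r * (if i = k then 1 else 0)
        - pdy S k x y / r * (if i = j then 1 else 0) := by
    intro i j k
    refine (pdy_congr hx hy (hN i j) k).trans ?_
    have hc : SlitSmooth U (fun _ _ => if i = j then (1 : ℝ) else 0) := contDiffOn_const
    have hc0 : pdy (fun _ _ : Vec n => if i = j then (1 : ℝ) else 0) k x y = 0 := by
      simp [pdy]
    have hNs : SlitSmooth U (Nc G i j) := (hG i).pdy hU j
    rw [pdy_sub_div_mul hU hx hy
        (hNs.sub (((hS.pdy hU j).div_const r).mul (SlitSmooth.coord i))) hS hc, hc0,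
      pdy_sub_div_mul hU hx hy hNs (hS.pdy hU j) (SlitSmooth.coord i), pdy_coord]
    simp only [Γc, Nc]
    ring
  have hX : ∀ i j, ∀ x ∈ U, ∀ y ∈ slit n,
      pdx (fun x y => G i x y - S x y / r * y i) j x y =
        pdx (G i) j x y - pdx S j x y / r * y i := fun i j x hx y hy =>
    pdx_sub_div_mul_coord hU hx hy (hG i) hS r i j
  have hXY : ∀ i j k, pdy (pdx (fun x y => G i x y - S x y / r * y i) j) k x y =
      pdy (pdx (G i) j) k x y - pdy (pdx S j) k x y / r * y i
        - pdx S j x y / r * (if i = k then 1 else 0) := by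
    intro i j k
    rw [pdy_congr hx hy (hX i j) k, pdy_sub_div_mul hU hx hy ((hG i).pdx hU j) (hS.pdx hU j)
      (SlitSmooth.coord i), pdy_coord]
    ring
  have e1 : ∑ j, y j * Γc G i j k x y = Nc G i k x y := by
    simpa [Γc, Nc] using (hG2 i).euler_pdy hU (hG i) hx hy k
  have e2 : ∑ j, y j * pdy (pdy S j) k x y = 0 := by
    simpa using hS1.euler_pdy (d := 0) hU hS hx hy k
  have e3 : ∑ j, y j * pdy S j x y = S x y := by simpa using hS1.euler hU hS hx hy
  have e4 : ∑ j, y j * Nc G i j x y = 2 * G i x y := by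
    simpa [Γc, Nc] using (hG2 i).euler hU (hG i) hx hy
  have s1 : ∑ j, y j * pdy (pdx (fun x y => G i x y - S x y / r * y i) j) k x y =
      ∑ j, y j * pdy (pdx (G i) j) k x y - (∑ j, y j * pdy (pdx S j) k x y) / r * y i
        - (∑ j, y j * pdx S j x y) / r * (if i = k then 1 else 0) := by
    simp only [hXY, Finset.sum_div, Finset.sum_mul, ← Finset.sum_sub_distrib]
    exact Finset.sum_congr rfl fun j _ => by ring
  have s2 : ∑ j, (G j x y - S x y / r * y j) *
        Γc (fun i x y => G i x y - S x y / r * y i) i j k x y =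
      ∑ j, G j x y * Γc G i j k x y - S x y / r * ∑ j, y j * Γc G i j k x y
        - (∑ j, G j x y * pdy (pdy S j) k x y) / r * y i
        - (∑ j, G j x y * pdy S j x y) / r * (if i = k then 1 else 0)
        + S x y / r ^ 2 * (∑ j, y j * pdy (pdy S j) k x y) * y i
        + S x y / r ^ 2 * (∑ j, y j * pdy S j x y) * (if i = k then 1 else 0)
        - ∑ j, (G j x y - S x y / r * y j) * (pdy S k x y / r) * (if i = j then 1 else 0) := by
    simp only [hΓ, Finset.sum_div, Finset.sum_mul, Finset.mul_sum, ← Finset.sum_sub_distrib,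
      ← Finset.sum_add_distrib]
    exact Finset.sum_congr rfl fun j _ => by ring
  have s3 : ∑ s, Nc (fun i x y => G i x y - S x y / r * y i) i s x y *
        Nc (fun i x y => G i x y - S x y / r * y i) s k x y =
      ∑ s, Nc G i s x y * Nc G s k x y - (∑ s, y s * Nc G i s x y) * (pdy S k x y / r)
        - (∑ s, pdy S s x y * Nc G s k x y) / r * y i
        + (∑ s, y s * pdy S s x y) * (pdy S k x y / r ^ 2) * y i
        + ∑ s, (pdy S s x y / r * y i * (S x y / r) - Nc G i s x y * (S x y / r))
            * (if s = k then 1 else 0)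
        - ∑ s, (S x y / r) * (Nc G s k x y - pdy S k x y / r * y s
            - S x y / r * (if s = k then 1 else 0)) * (if i = s then 1 else 0) := by
    simp only [hN _ _ x hx y hy, Finset.sum_div, Finset.sum_mul, ← Finset.sum_sub_distrib,
      ← Finset.sum_add_distrib]
    exact Finset.sum_congr rfl fun j _ => by ring
  simp only [Finset.sum_ite_eq, Finset.sum_ite_eq', mul_ite, mul_one, mul_zero, Finset.mem_univ,
    if_true] at s2 s3
  simp only [Riem]
  rw [s1, s2, s3, hX i k x hx y hy, e1, e2, e3, e4]
  split_ifs <;> ring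

theorem sum_hD_mul (hU : IsOpen U) (hG : ∀ i, SlitSmooth U (G i))
    (hG2 : ∀ i, SlitHom U 2 (G i)) (S : Vec n → Vec n → ℝ) (hx : x ∈ U) (hy : y ∈ slit n) :
    ∑ m, hD G S m x y * y m =
      ∑ m, y m * pdx S m x y - 2 * ∑ l, G l x y * pdy S l x y := by
  have e : ∀ l, ∑ m, y m * Nc G l m x y = 2 * G l x y := fun l => by
    simpa [Γc, Nc] using (hG2 l).euler hU (hG l) hx hy
  have : ∑ m, (∑ l, Nc G l m x y * pdy S l x y) * y m = 2 * ∑ l, G l x y * pdy S l x y := by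
    simp only [Finset.sum_mul, Finset.mul_sum]
    rw [Finset.sum_comm]
    refine Finset.sum_congr rfl fun l _ => ?_
    rw [← mul_assoc, ← e l, Finset.sum_mul]
    exact Finset.sum_congr rfl fun m _ => by ring
  rw [← this, ← Finset.sum_sub_distrib]
  exact Finset.sum_congr rfl fun m _ => by simp only [hD]; ring

theorem sum_pdy_hD_mul (hU : IsOpen U) (hG : ∀ i, SlitSmooth U (G i))
    (hG2 : ∀ i, SlitHom U 2 (G i)) {S : Vec n → Vec n → ℝ} (hS : SlitSmooth U S)
    (hx : x ∈ U) (hy : y ∈ slit n) (k : Fin n) :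
    ∑ m, pdy (hD G S m) k x y * y m =
      ∑ m, y m * pdy (pdx S m) k x y - ∑ l, pdy S l x y * Nc G l k x y
        - 2 * ∑ l, G l x y * pdy (pdy S l) k x y := by
  have hNs : ∀ l m, SlitSmooth U (Nc G l m) := fun l m => (hG l).pdy hU m
  have hd : ∀ m, pdy (hD G S m) k x y = pdy (pdx S m) k x y
      - ∑ l, (Nc G l m x y * pdy (pdy S l) k x y + pdy S l x y * Γc G l m k x y) := by
    intro m
    refine (pdy_sub hU hx hy (hS.pdx hU m)
      (SlitSmooth.sum fun l => (hNs l m).mul (hS.pdy hU l)) k).trans ?_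
    rw [pdy_sum hU hx hy fun l => (hNs l m).mul (hS.pdy hU l)]
    exact congrArg _ (Finset.sum_congr rfl fun l _ => pdy_mul hU hx hy (hNs l m) (hS.pdy hU l) k)
  have e : ∀ l, ∑ m, y m * Nc G l m x y = 2 * G l x y := fun l => by
    simpa [Γc, Nc] using (hG2 l).euler hU (hG l) hx hy
  have e1 : ∀ l, ∑ m, y m * Γc G l m k x y = Nc G l k x y := fun l => by
    simpa [Γc, Nc] using (hG2 l).euler_pdy hU (hG l) hx hy k
  have : ∑ m, (∑ l, (Nc G l m x y * pdy (pdy S l) k x y + pdy S l x y * Γc G l m k x y)) * y m =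
      ∑ l, pdy S l x y * Nc G l k x y + 2 * ∑ l, G l x y * pdy (pdy S l) k x y := by
    simp only [Finset.sum_mul, Finset.mul_sum, ← Finset.sum_add_distrib]
    rw [Finset.sum_comm]
    refine Finset.sum_congr rfl fun l _ => ?_
    rw [← mul_assoc, ← e l, ← e1 l, Finset.sum_mul, Finset.mul_sum, ← Finset.sum_add_distrib]
    exact Finset.sum_congr rfl fun m _ => by ring
  rw [sub_sub, ← this, ← Finset.sum_sub_distrib]
  exact Finset.sum_congr rfl fun m _ => by rw [hd]; ring

theorem pdy_tauQ (hU : IsOpen U) (hG : ∀ i, SlitSmooth U (G i)) (hσ : IsVolumeForm U σ)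
    (hx : x ∈ U) (hy : y ∈ slit n) (k : Fin n) :
    pdy (tauQ G σ) k x y = 2 * Scurv G σ x y * pdy (Scurv G σ) k x y / ((n : ℝ) + 1) ^ 2
      + (1 / ((n : ℝ) + 1)) *
        (∑ m, pdy (hD G (Scurv G σ) m) k x y * y m + hD G (Scurv G σ) k x y) := by
  have hS := Scurv_smooth hU hG hσ
  have hH := fun m => hD_smooth hU hG hS m
  have hsum : SlitSmooth U (fun x y => ∑ m, hD G (Scurv G σ) m x y * y m) :=
    SlitSmooth.sum fun m => (hH m).mul (SlitSmooth.coord m)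
  have h0 : ∀ x ∈ U, ∀ y ∈ slit n, tauQ G σ x y =
      (Scurv G σ x y / ((n : ℝ) + 1)) * (Scurv G σ x y / ((n : ℝ) + 1))
        - (∑ m, hD G (Scurv G σ) m x y * y m) / ((n : ℝ) + 1) * (-1) := by
    intro x _ y _
    simp only [tauQ]
    ring
  have hc : SlitSmooth U (fun _ _ => (-1 : ℝ)) := contDiffOn_const
  have hc0 : pdy (fun _ _ : Vec n => (-1 : ℝ)) k x y = 0 := by simp [pdy]
  have hz : SlitSmooth U (fun _ _ => (0 : ℝ)) := contDiffOn_const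
  have hq : pdy (fun x y => Scurv G σ x y / ((n : ℝ) + 1)) k x y =
      pdy (Scurv G σ) k x y / ((n : ℝ) + 1) := by
    have h1 := pdy_sub_div_mul hU hx hy hz hS hc ((n : ℝ) + 1) k
    simp only [hc0, zero_sub, mul_neg, mul_one, neg_neg, mul_zero, add_zero] at h1
    rw [h1]
    simp [pdy]
  have hq' := hS.div_const ((n : ℝ) + 1)
  rw [pdy_congr hx hy h0 k, pdy_sub_div_mul hU hx hy (hq'.mul hq') hsum hc,
    pdy_mul hU hx hy hq' hq', hq, hc0,
    pdy_sum hU hx hy fun m => (hH m).mul (SlitSmooth.coord m)]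
  simp only [pdy_mul hU hx hy (hH _) (SlitSmooth.coord _), pdy_coord, mul_ite, mul_one, mul_zero,
    Finset.sum_add_distrib, Finset.sum_ite_eq', Finset.mem_univ, if_true]
  generalize (n : ℝ) + 1 = r
  simp only [mul_comm (y _)]
  ring

theorem Riem_Ghat (hU : IsOpen U) (hG : ∀ i, SlitSmooth U (G i))
    (hG2 : ∀ i, SlitHom U 2 (G i)) (hσ : IsVolumeForm U σ)
    (hx : x ∈ U) (hy : y ∈ slit n) (i k : Fin n) :
    Riem (Ghat G σ) i k x y =
      Riem G i k x y + tauQ G σ x y * (if i = k then 1 else 0)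
        - (1/2) * pdy (tauQ G σ) k x y * y i
        + (3 * ((1/2) * (∑ m, pdy (hD G (Scurv G σ) m) k x y * y m
            - hD G (Scurv G σ) k x y)) / ((n : ℝ) + 1)) * y i := by
  have hS := Scurv_smooth hU hG hσ
  refine (Riem_projective_change hU hG hG2 hS (Scurv_hom hU hG hG2) ((n : ℝ) + 1)
    hx hy i k).trans ?_
  have hk : ∑ l, Nc G l k x y * pdy (Scurv G σ) l x y =
      ∑ l, pdy (Scurv G σ) l x y * Nc G l k x y :=
    Finset.sum_congr rfl fun l _ => mul_comm _ _
  rw [pdy_tauQ hU hG hσ hx hy, tauQ, sum_hD_mul hU hG hG2 _ hx hy,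
    sum_pdy_hD_mul hU hG hG2 hS hx hy, hD, hk]
  ring

theorem Ricci_Ghat (hn : 2 ≤ n) (hU : IsOpen U) (hG : ∀ i, SlitSmooth U (G i))
    (hG2 : ∀ i, SlitHom U 2 (G i)) (hσ : IsVolumeForm U σ) (hx : x ∈ U) (hy : y ∈ slit n) :
    Ricci (Ghat G σ) x y = Ricci G x y + tauQ G σ x y := by
  have hS := Scurv_smooth hU hG hσ
  have hS1 : SlitHom U 1 (Scurv G σ) := Scurv_hom hU hG hG2
  have e1 : ∑ k, (∑ m, pdy (hD G (Scurv G σ) m) k x y * y m) * y k =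
      ∑ m, hD G (Scurv G σ) m x y * y m := by
    simp only [Finset.sum_mul]
    rw [Finset.sum_comm]
    refine Finset.sum_congr rfl fun m _ => ?_
    have h := (hS1.hD hU hG hG2 hS m).euler hU (hD_smooth hU hG hS m) hx hy
    rw [Nat.cast_one, one_mul] at h
    rw [← h, Finset.sum_mul]
    exact Finset.sum_congr rfl fun k _ => by ring
  have e2 : ∑ j, y j * pdy (Scurv G σ) j x y = Scurv G σ x y := by
    simpa using hS1.euler hU hS hx hy
  have e3 : ∑ m, Riem (Ghat G σ) m m x y = ∑ m, Riem G m m x y + n * tauQ G σ x y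
      - Scurv G σ x y / ((n : ℝ) + 1) ^ 2 * ∑ j, y j * pdy (Scurv G σ) j x y
      + (1 / ((n : ℝ) + 1)) * ∑ k, (∑ m, pdy (hD G (Scurv G σ) m) k x y * y m) * y k
      - (2 / ((n : ℝ) + 1)) * ∑ m, hD G (Scurv G σ) m x y * y m := by
    have : (n : ℝ) * tauQ G σ x y = ∑ _m : Fin n, tauQ G σ x y := by simp
    rw [this, Finset.mul_sum, Finset.mul_sum, Finset.mul_sum, ← Finset.sum_add_distrib,
      ← Finset.sum_sub_distrib, ← Finset.sum_add_distrib, ← Finset.sum_sub_distrib]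
    simp only [Riem_Ghat hU hG hG2 hσ hx hy, pdy_tauQ hU hG hσ hx hy, if_true]
    refine Finset.sum_congr rfl fun m _ => ?_
    generalize (n : ℝ) + 1 = r
    ring
  have hn1 : (n : ℝ) - 1 ≠ 0 := by
    have : (2 : ℝ) ≤ n := by exact_mod_cast hn
    linarith
  simp only [Ricci]
  rw [e3, e1, e2, div_add' _ _ _ hn1]
  congr 1
  simp only [tauQ]
  generalize (n : ℝ) + 1 = r
  ring

end Spray

end SlitCalculus

/-- Lemma 2.2: the Riemann curvatures and Ricci scalars of `Ĝ` and `G` are related by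
`R̂^i_k = R^i_k + τ δ^i_k - ½ τ_{·k} y^i + (3χ_k/(n+1)) y^i` and `R̂ = R + τ`, where
`χ_k = ½(S_{|m·k} y^m - S_{|k})`. -/
theorem stmt_12 {n : ℕ} (hn : 2 ≤ n) (U : Set (Vec n)) (hU : IsOpen U) (hUne : U.Nonempty)
    (G : Fin n → Vec n → Vec n → ℝ) (hG : IsSpray U G)
    (σ : Vec n → ℝ) (hσ : IsVolumeForm U σ) :
    ∀ x ∈ U, ∀ y ∈ slit n, ∀ i k : Fin n,
      (Riem (Ghat G σ) i k x y =
        Riem G i k x y + tauQ G σ x y * (if i = k then 1 else 0)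
          - (1/2) * pdy (tauQ G σ) k x y * y i
          + (3 * ((1/2) * (∑ m, pdy (hD G (Scurv G σ) m) k x y * y m
              - hD G (Scurv G σ) k x y)) / ((n : ℝ) + 1)) * y i) ∧
      (Ricci (Ghat G σ) x y = Ricci G x y + tauQ G σ x y) := by
  intro x hx y hy i k
  exact ⟨Riem_Ghat hU hG.1 hG.2 hσ hx hy i k, Ricci_Ghat hn hU hG.1 hG.2 hσ hx hy⟩

end BerwaldWeyl
end
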